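/- First-order optimality condition for the semi-discretized parameter identification problem: Assume that for every direction v ∈ ℝᵐ the control-to-state map ξ ↦ u(t,ξ) is differentiable with derivative w(t) = D_ξ u(t,ξ)[v] solving the linearized state equation M₁ w'(t) = D_u F(u(t,ξ),ξ) w(t) + D_ξ F(u(t,ξ),ξ) v on [0,T] with w(0) = D u₀(ξ)[v]. If ξ* ∈ ℝᵐ is a local minimizer of the reduced cost Ĵ, and p : [0,T] → ℝⁿ solves the adjoint problem M₁ p'(t) = −(D_u F(u(t,ξ*),ξ*))ᵀ p(t) with terminal condition M₁ p(T) = u_D − u(T,ξ*), then for every v ∈ ℝᵐ: ∫₀ᵀ (D_ξ F(u(t,ξ*),ξ*) v) · p(t) dt + (D u₀(ξ*) v) · (M₁ p(0)) + δ (ξ_p − ξ*) · v = 0. -/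

import Mathlib

open Matrix intervalIntegral

theorem HasDerivAt.dotProduct {n : Type*} [Fintype n] {f g : ℝ → n → ℝ} {f' g' : n → ℝ} {t : ℝ}
    (hf : HasDerivAt f f' t) (hg : HasDerivAt g g' t) :
    HasDerivAt (fun s => f s ⬝ᵥ g s) (f' ⬝ᵥ g t + f t ⬝ᵥ g') t := by
  simp only [_root_.dotProduct, ← Finset.sum_add_distrib]
  exact HasDerivAt.fun_sum fun i _ => (hasDerivAt_pi.1 hf i).mul (hasDerivAt_pi.1 hg i)

theorem HasDerivAt.matrix_mulVec {m n : Type*} [Fintype m] [Fintype n] (A : Matrix m n ℝ)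
    {f : ℝ → n → ℝ} {f' : n → ℝ} {t : ℝ} (hf : HasDerivAt f f' t) :
    HasDerivAt (fun s => A *ᵥ f s) (A *ᵥ f') t :=
  (LinearMap.toContinuousLinearMap A.mulVecLin).hasFDerivAt.comp_hasDerivAt t hf

theorem ContinuousOn.mulVec_dotProduct {m n : Type*} [Fintype m] [Fintype n] {s : Set ℝ}
    {A : ℝ → Matrix m n ℝ} {g : ℝ → m → ℝ} (hA : ContinuousOn A s) (v : n → ℝ)
    (hg : ContinuousOn g s) : ContinuousOn (fun t => (A t *ᵥ v) ⬝ᵥ g t) s := by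
  have hA' : Continuous fun t : s => A t := hA.domRestrict
  have hg' : Continuous fun t : s => g t := hg.domRestrict
  exact continuousOn_iff_continuous_domRestrict.2
    ((hA'.matrix_mulVec continuous_const).dotProduct hg')

/-- **First-order optimality condition for the semi-discretized parameter
identification problem.**
Setting: `M₁` symmetric invertible, `F` continuously differentiable with partial
derivatives `Fu = D_u F` and `Fξ = D_ξ F`, `u₀` continuously differentiable with
derivative `Du₀`, and for each control `ξ` the state `u(·,ξ)` a `C¹` solution of
`M₁ u' = F(u,ξ)`, `u(0,ξ) = u₀(ξ)`.  For every direction `v` the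
control-to-state map is (Gâteaux) differentiable with derivative
`w(t) = D_ξ u(t,ξ)[v]` solving the linearized equation
`M₁ w' = D_u F(u,ξ) w + D_ξ F(u,ξ) v`, `w(0) = D u₀(ξ)[v]`.
If `ξ*` is a local minimizer of the reduced cost
`Ĵ(ξ) = (1/2)‖u(T,ξ) − u_D‖² + (δ/2)‖ξ − ξ_p‖²` and `p` solves the adjoint
problem `M₁ p' = −(D_u F(u,ξ*),ξ*)ᵀ p`, `M₁ p(T) = u_D − u(T,ξ*)`, then for
every `v ∈ ℝᵐ`:
`∫₀ᵀ (D_ξ F(u(t,ξ*),ξ*) v) · p(t) dt + (D u₀(ξ*) v) · (M₁ p(0))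
  + δ (ξ_p − ξ*) · v = 0`. -/
theorem first_order_optimality_condition
    {n m : ℕ} (hn : 0 < n) (hm : 0 < m) (T : ℝ) (hT : 0 < T)
    (M₁ : Matrix (Fin n) (Fin n) ℝ) (hM₁ : M₁.IsSymm) (hM₁inv : IsUnit M₁.det)
    -- the flux term `F` and its partial derivatives
    (F : (Fin n → ℝ) → (Fin m → ℝ) → Fin n → ℝ)
    (Fu : (Fin n → ℝ) → (Fin m → ℝ) → Matrix (Fin n) (Fin n) ℝ)
    (Fξ : (Fin n → ℝ) → (Fin m → ℝ) → Matrix (Fin n) (Fin m) ℝ)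
    (hFu : ∀ x ζ, HasFDerivAt (fun y => F y ζ)
      (LinearMap.toContinuousLinearMap (Fu x ζ).mulVecLin) x)
    (hFξ : ∀ x ζ, HasFDerivAt (fun η => F x η)
      (LinearMap.toContinuousLinearMap (Fξ x ζ).mulVecLin) ζ)
    (hFuc : Continuous fun q : (Fin n → ℝ) × (Fin m → ℝ) => Fu q.1 q.2)
    (hFξc : Continuous fun q : (Fin n → ℝ) × (Fin m → ℝ) => Fξ q.1 q.2)
    -- the initial datum and its derivative
    (u₀ : (Fin m → ℝ) → Fin n → ℝ)
    (Du₀ : (Fin m → ℝ) → Matrix (Fin n) (Fin m) ℝ)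
    (hu₀ : ∀ ζ, HasFDerivAt u₀
      (LinearMap.toContinuousLinearMap (Du₀ ζ).mulVecLin) ζ)
    (hDu₀c : Continuous Du₀)
    -- data, prior, regularization parameter
    (uD : Fin n → ℝ) (ξp : Fin m → ℝ) (δ : ℝ) (hδ : 0 ≤ δ)
    -- the state: a `C¹` solution of `M₁ u' = F(u, ξ)`, `u(0) = u₀(ξ)`
    (u du : ℝ → (Fin m → ℝ) → Fin n → ℝ)
    (hu0 : ∀ ζ, u 0 ζ = u₀ ζ)
    (hu' : ∀ ζ, ∀ t ∈ Set.Icc (0 : ℝ) T, HasDerivAt (fun s => u s ζ) (du t ζ) t)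
    (hu'c : ∀ ζ, ContinuousOn (fun t => du t ζ) (Set.Icc (0 : ℝ) T))
    (hstate : ∀ ζ, ∀ t ∈ Set.Icc (0 : ℝ) T, M₁ *ᵥ du t ζ = F (u t ζ) ζ)
    -- differentiability of the control-to-state map, with derivative `w`
    -- solving the linearized state equation
    (w dw : (Fin m → ℝ) → (Fin m → ℝ) → ℝ → Fin n → ℝ)
    (hgateaux : ∀ ζ v, ∀ t ∈ Set.Icc (0 : ℝ) T,
      Filter.Tendsto (fun ε : ℝ => ε⁻¹ • (u t (ζ + ε • v) - u t ζ))
        (nhdsWithin 0 {0}ᶜ) (nhds (w ζ v t)))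
    (hw' : ∀ ζ v, ∀ t ∈ Set.Icc (0 : ℝ) T, HasDerivAt (w ζ v) (dw ζ v t) t)
    (hlin : ∀ ζ v, ∀ t ∈ Set.Icc (0 : ℝ) T,
      M₁ *ᵥ dw ζ v t = Fu (u t ζ) ζ *ᵥ w ζ v t + Fξ (u t ζ) ζ *ᵥ v)
    (hw0 : ∀ ζ v, w ζ v 0 = Du₀ ζ *ᵥ v)
    -- the reduced cost functional
    (Jhat : (Fin m → ℝ) → ℝ)
    (hJhat : ∀ ζ, Jhat ζ = (1/2) * ((u T ζ - uD) ⬝ᵥ (u T ζ - uD))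
      + (δ/2) * ((ζ - ξp) ⬝ᵥ (ζ - ξp)))
    -- the local minimizer
    (ξstar : Fin m → ℝ) (hmin : IsLocalMin Jhat ξstar)
    -- the adjoint state
    (p dp : ℝ → Fin n → ℝ)
    (hp' : ∀ t ∈ Set.Icc (0 : ℝ) T, HasDerivAt p (dp t) t)
    (hp'c : ContinuousOn dp (Set.Icc (0 : ℝ) T))
    (hadj : ∀ t ∈ Set.Icc (0 : ℝ) T,
      M₁ *ᵥ dp t = -((Fu (u t ξstar) ξstar)ᵀ *ᵥ p t))
    (hterm : M₁ *ᵥ p T = uD - u T ξstar) :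
    ∀ v : Fin m → ℝ,
      (∫ t in (0 : ℝ)..T, (Fξ (u t ξstar) ξstar *ᵥ v) ⬝ᵥ p t)
        + (Du₀ ξstar *ᵥ v) ⬝ᵥ (M₁ *ᵥ p 0)
        + δ * ((ξp - ξstar) ⬝ᵥ v) = 0 := by
  intro v
  have hduality : (∫ t in (0 : ℝ)..T, (Fξ (u t ξstar) ξstar *ᵥ v) ⬝ᵥ p t)
      = w ξstar v T ⬝ᵥ (M₁ *ᵥ p T) - w ξstar v 0 ⬝ᵥ (M₁ *ᵥ p 0) := by
    refine integral_eq_sub_of_hasDerivAt (f := fun t => w ξstar v t ⬝ᵥ (M₁ *ᵥ p t)) ?_ ?_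
    · intro t ht
      rw [Set.uIcc_of_le hT.le] at ht
      refine ((hw' ξstar v t ht).dotProduct ((hp' t ht).matrix_mulVec M₁)).congr_deriv ?_
      rw [hadj t ht, dotProduct_mulVec (dw ξstar v t), ← mulVec_transpose, hM₁.eq,
        hlin ξstar v t ht, dotProduct_neg, dotProduct_mulVec (w ξstar v t), vecMul_transpose,
        add_dotProduct]
      ring
    · refine ContinuousOn.intervalIntegrable ?_
      rw [Set.uIcc_of_le hT.le]
      have hu : ContinuousOn (fun t => u t ξstar) (Set.Icc 0 T) := fun t ht =>
        (hu' ξstar t ht).continuousAt.continuousWithinAt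
      have hp : ContinuousOn p (Set.Icc 0 T) := fun t ht =>
        (hp' t ht).continuousAt.continuousWithinAt
      have hF : ContinuousOn (fun t => Fξ (u t ξstar) ξstar) (Set.Icc 0 T) :=
        hFξc.comp_continuousOn (hu.prodMk continuousOn_const)
      exact hF.mulVec_dotProduct v hp
  have hstationary : (u T ξstar - uD) ⬝ᵥ w ξstar v T + δ * ((ξstar - ξp) ⬝ᵥ v) = 0 := by
    have hline : HasDerivAt (fun ε : ℝ => ξstar + ε • v) v 0 := by
      simpa using ((hasDerivAt_id (0 : ℝ)).smul_const v).const_add ξstar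
    have hu : HasDerivAt (fun ε : ℝ => u T (ξstar + ε • v)) (w ξstar v T) 0 := by
      rw [hasDerivAt_iff_tendsto_slope_zero]
      simpa using hgateaux ξstar v T ⟨hT.le, le_rfl⟩
    have hJ : HasDerivAt (fun ε : ℝ => Jhat (ξstar + ε • v))
        ((u T ξstar - uD) ⬝ᵥ w ξstar v T + δ * ((ξstar - ξp) ⬝ᵥ v)) 0 := by
      simp only [hJhat]
      have hu := hu.sub_const uD
      have hl := hline.sub_const ξp
      refine (((hu.dotProduct hu).const_mul (1 / 2)).fun_add
        ((hl.dotProduct hl).const_mul (δ / 2))).congr_deriv ?_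
      simp only [zero_smul, add_zero]
      rw [dotProduct_comm (w ξstar v T), dotProduct_comm v]
      ring
    have hmin' : IsLocalMin Jhat (ξstar + (0 : ℝ) • v) := by simpa using hmin
    have hlocal : IsLocalMin (fun ε : ℝ => Jhat (ξstar + ε • v)) 0 :=
      IsMinFilter.comp_tendsto (g := fun ε : ℝ => ξstar + ε • v) hmin'
        hline.continuousAt
    exact hlocal.hasDerivAt_eq_zero hJ
  rw [hduality, hterm, hw0 ξstar v]
  rw [dotProduct_comm, ← neg_sub (u T ξstar) uD, ← neg_sub ξstar ξp, neg_dotProduct,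
    neg_dotProduct]
  linarith
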